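/- arXiv:2511.00194 — 6 statements merged into one kernel-verified Lean document; each statement's English description precedes it below -/
import Mathlib

section
/- Let O_1,…,O_P (P ≥ 1) be the sizes of the classes of a partition of n elements (each O_i ≥ 1, Σ O_i = n), let m̲ = min_i O_i and m̄ = max_i O_i. If there exist two distinct indices i ≠ j such that m̲ < O_i ≤ O_j < m̄ (i.e., O_i = m̲ + r₁ and O_j = m̲ + r₂ with 1 ≤ r₁ ≤ r₂ < m̄ − m̲), then the sum of squares S = Σ_i O_i² is not maximal: there exists another size vector O'_1,…,O'_P of positive integers with Σ O'_i = n, min_i O'_i = m̲, max_i O'_i = m̄, and Σ_i O'_i² > Σ_i O_i². -/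
/-- Changing two values of a finite family replaces the two corresponding terms of a sum. -/
theorem sum_update_update_add {ι α M : Type*} [Fintype ι] [DecidableEq ι] [AddCommMonoid M]
    (f : α → M) (g : ι → α) {i j : ι} (hij : i ≠ j) (a b : α) :
    ∑ k, f (Function.update (Function.update g i a) j b k) + (f (g i) + f (g j)) =
      ∑ k, f (g k) + (f a + f b) := by
  have split (h : ι → M) : ∑ k, h k = h i + h j + ∑ k ∈ {i, j}ᶜ, h k := by
    rw [← Finset.sum_add_sum_compl {i, j} h, Finset.sum_pair hij]
  have rest : ∑ k ∈ {i, j}ᶜ, f (Function.update (Function.update g i a) j b k) =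
      ∑ k ∈ {i, j}ᶜ, f (g k) := by
    refine Finset.sum_congr rfl fun k hk => ?_
    simp only [Finset.mem_compl, Finset.mem_insert, Finset.mem_singleton, not_or] at hk
    rw [Function.update_of_ne hk.2, Function.update_of_ne hk.1]
  rw [split, split fun k => f (g k), rest, Function.update_self, Function.update_of_ne hij,
    Function.update_self]
  abel

/-- If two class sizes lie strictly between the minimum `mlo` and maximum `mhi`,
then the sum of squares is not maximal among size vectors with sum `n`,
minimum `mlo` and maximum `mhi`. -/
theorem partition_two_middle_not_maximal
    (n P : ℕ) (hP : 1 ≤ P) (O : Fin P → ℕ)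
    (hO : ∀ i, 1 ≤ O i) (hsum : ∑ i, O i = n)
    (mlo mhi : ℕ)
    (hlo : ∀ i, mlo ≤ O i) (hlo' : ∃ i, O i = mlo)
    (hhi : ∀ i, O i ≤ mhi) (hhi' : ∃ i, O i = mhi)
    (i j : Fin P) (hij : i ≠ j)
    (h1 : mlo < O i) (h2 : O i ≤ O j) (h3 : O j < mhi) :
    ∃ O' : Fin P → ℕ,
      (∀ k, 1 ≤ O' k) ∧ (∑ k, O' k = n) ∧
      (∀ k, mlo ≤ O' k) ∧ (∃ k, O' k = mlo) ∧
      (∀ k, O' k ≤ mhi) ∧ (∃ k, O' k = mhi) ∧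
      ∑ k, (O k) ^ 2 < ∑ k, (O' k) ^ 2 := by
  obtain ⟨p, hp⟩ := hlo'
  obtain ⟨q, hq⟩ := hhi'
  have update_apply (k : Fin P) :
      Function.update (Function.update O i (O i - 1)) j (O j + 1) k =
        if k = j then O j + 1 else if k = i then O i - 1 else O k := by
    simp only [Function.update_apply]
  have sum_id := sum_update_update_add id O hij (O i - 1) (O j + 1)
  have sum_sq := sum_update_update_add (· ^ 2) O hij (O i - 1) (O j + 1)
  simp only [id_eq] at sum_id
  refine ⟨Function.update (Function.update O i (O i - 1)) j (O j + 1),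
    fun k => ?_, ?_, fun k => ?_, ⟨p, ?_⟩, fun k => ?_, ⟨q, ?_⟩, ?_⟩
  · have := hO k
    have := hO p
    rw [update_apply]
    split_ifs <;> omega
  · have := hO i
    omega
  · have := hlo k
    rw [update_apply]
    split_ifs <;> omega
  · have hpj : p ≠ j := by rintro rfl; omega
    have hpi : p ≠ i := by rintro rfl; omega
    rw [update_apply, if_neg hpj, if_neg hpi, hp]
  · have := hhi k
    rw [update_apply]
    split_ifs <;> omega
  · have hqj : q ≠ j := by rintro rfl; omega
    have hqi : q ≠ i := by rintro rfl; omega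
    rw [update_apply, if_neg hqj, if_neg hqi, hq]
  · have sq_lt : O i ^ 2 + O j ^ 2 < (O i - 1) ^ 2 + (O j + 1) ^ 2 := by
      obtain ⟨c, hc⟩ := Nat.exists_eq_add_of_lt h1
      rw [hc] at h2 ⊢
      rw [Nat.add_sub_cancel]
      nlinarith
    omega
end

section
/- Let O_1,…,O_P (P ≥ 1) be the sizes of the classes of a partition of n elements (each O_i ≥ 1, Σ O_i = n), let m̲ = min_i O_i, m̄ = max_i O_i, and R = n − P·m̲. Suppose m̄ − m̲ > 0, R mod (m̄ − m̲) > 0, and S = Σ_i O_i² is maximal among all positive size vectors with sum n, minimum m̲ and maximum m̄. Then there is exactly one index i with m̲ < O_i < m̄, and for that index O_i = m̲ + (R mod (m̄ − m̲)). -/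
/-- Moving one unit from a nonempty class to another class that is at least as large keeps the sum and strictly increases the sum of squares. -/
theorem sum_sq_lt_sum_sq_of_transfer {ι : Type*} [Fintype ι] [DecidableEq ι] (O : ι → ℕ) {i j : ι}
    (hij : i ≠ j) (hj : 0 < O j) (hle : O j ≤ O i) :
    ∑ k, Function.update (Function.update O i (O i + 1)) j (O j - 1) k = ∑ k, O k ∧
      ∑ k, O k ^ 2 <
        ∑ k, Function.update (Function.update O i (O i + 1)) j (O j - 1) k ^ 2 := by
  obtain ⟨b, hb⟩ : ∃ b, O j = b + 1 := ⟨O j - 1, by omega⟩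
  set O' := Function.update (Function.update O i (O i + 1)) j (O j - 1) with hO'
  have h_i : O' i = O i + 1 := by simp [hO', hij]
  have h_j : O' j = b := by simp [hO', hb]
  have h_other : ∀ k, k ≠ i → k ≠ j → O' k = O k := fun k hki hkj => by simp [hO', hki, hkj]
  constructor
  · have h : ∑ k, (O' k + if k = j then 1 else 0) = ∑ k, (O k + if k = i then 1 else 0) := by
      refine Finset.sum_congr rfl fun k _ => ?_
      by_cases hki : k = i
      · subst hki; simp [h_i, hij]
      · by_cases hkj : k = j
        · subst hkj; simp [h_j, hb, hki]
        · simp [h_other k hki hkj, hki, hkj]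
    simpa [Finset.sum_add_distrib] using h
  · have h : ∑ k, (O' k ^ 2 + if k = j then 2 * b + 1 else 0) =
        ∑ k, (O k ^ 2 + if k = i then 2 * O i + 1 else 0) := by
      refine Finset.sum_congr rfl fun k _ => ?_
      by_cases hki : k = i
      · subst hki; simp [h_i, hij]; ring
      · by_cases hkj : k = j
        · subst hkj; simp [h_j, hb, hki]; ring
        · simp [h_other k hki hkj, hki, hkj]
    simp only [Finset.sum_add_distrib, Finset.sum_ite_eq', Finset.mem_univ, if_true] at h
    omega

/-- If all classes other than `i` have extreme size, the excess over the minimum is congruent to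
that of `i` modulo the range. -/
theorem sum_sub_card_mul_modEq {P : ℕ} (O : Fin P → ℕ) (mlo mhi : ℕ) (hlo : ∀ k, mlo ≤ O k)
    (i : Fin P) (h : ∀ k, k ≠ i → O k = mlo ∨ O k = mhi) :
    ∑ k, O k - P * mlo ≡ O i - mlo [MOD mhi - mlo] := by
  have hR : ∑ k, O k - P * mlo = ∑ k, (O k - mlo) := by
    rw [Finset.sum_tsub_distrib _ fun k _ => hlo k]
    simp
  have hdvd : (mhi - mlo) ∣ ∑ k ∈ Finset.univ.erase i, (O k - mlo) := by
    refine Finset.dvd_sum fun k hk => ?_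
    rcases h k (Finset.ne_of_mem_erase hk) with hk | hk <;> simp [hk]
  rw [hR, ← Finset.add_sum_erase _ _ (Finset.mem_univ i)]
  simpa using (Nat.ModEq.refl (O i - mlo)).add ((Nat.modEq_zero_iff_dvd).2 hdvd)

/-- If `S = Σ Oᵢ²` is maximal, `mhi - mlo > 0` and `R mod (mhi - mlo) > 0`, then there
is exactly one class size strictly between `mlo` and `mhi`, and it equals
`mlo + R mod (mhi - mlo)`. -/
theorem partition_unique_middle_of_maximal
    (n P : ℕ) (hP : 1 ≤ P) (O : Fin P → ℕ)
    (hO : ∀ i, 1 ≤ O i) (hsum : ∑ i, O i = n)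
    (mlo mhi : ℕ)
    (hlo : ∀ i, mlo ≤ O i) (hlo' : ∃ i, O i = mlo)
    (hhi : ∀ i, O i ≤ mhi) (hhi' : ∃ i, O i = mhi)
    (hrange : 0 < mhi - mlo)
    (hmod : 0 < (n - P * mlo) % (mhi - mlo))
    (hmaximal : ∀ O' : Fin P → ℕ, (∀ k, 1 ≤ O' k) → (∑ k, O' k = n) →
      (∀ k, mlo ≤ O' k) → (∃ k, O' k = mlo) →
      (∀ k, O' k ≤ mhi) → (∃ k, O' k = mhi) →
      ∑ k, (O' k) ^ 2 ≤ ∑ k, (O k) ^ 2) :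
    (∃! i, mlo < O i ∧ O i < mhi) ∧
    (∀ i, mlo < O i → O i < mhi → O i = mlo + (n - P * mlo) % (mhi - mlo)) := by
  have no_two : ∀ i j, i ≠ j → mlo < O i → O i < mhi → mlo < O j → O j < mhi →
      ¬ O j ≤ O i := by
    intro i j hij hi hi' hj hj' hle
    obtain ⟨h_sum, hlt⟩ := sum_sq_lt_sum_sq_of_transfer O hij (hO j) hle
    have h_bounds : ∀ k, mlo ≤ Function.update (Function.update O i (O i + 1)) j (O j - 1) k ∧
        Function.update (Function.update O i (O i + 1)) j (O j - 1) k ≤ mhi := by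
      intro k
      have := hlo k
      have := hhi k
      simp only [Function.update_apply]
      split_ifs <;> omega
    have h_keep : ∀ k, k ≠ i → k ≠ j →
        Function.update (Function.update O i (O i + 1)) j (O j - 1) k = O k :=
      fun k hki hkj => by simp [hki, hkj]
    have hmlo : 1 ≤ mlo := by
      obtain ⟨k, hk⟩ := hlo'
      exact hk ▸ hO k
    obtain ⟨a, ha⟩ := hlo'
    obtain ⟨b, hb⟩ := hhi'
    refine (hmaximal _ (fun k => hmlo.trans (h_bounds k).1) (h_sum.trans hsum)
      (fun k => (h_bounds k).1) ⟨a, ?_⟩ (fun k => (h_bounds k).2) ⟨b, ?_⟩).not_gt hlt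
    · rw [h_keep a (by rintro rfl; omega) (by rintro rfl; omega), ha]
    · rw [h_keep b (by rintro rfl; omega) (by rintro rfl; omega), hb]
  have unique : ∀ i j, mlo < O i → O i < mhi → mlo < O j → O j < mhi → i = j := by
    intro i j hi hi' hj hj'
    by_contra hij
    rcases le_total (O j) (O i) with h | h
    · exact no_two i j hij hi hi' hj hj' h
    · exact no_two j i (Ne.symm hij) hj hj' hi hi' h
  have extreme : ∀ k, ¬ (mlo < O k ∧ O k < mhi) → O k = mlo ∨ O k = mhi := by
    intro k hk
    have := hlo k
    have := hhi k
    omega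
  constructor
  · suffices h : ∃ i, mlo < O i ∧ O i < mhi by
      obtain ⟨i, hi⟩ := h
      exact ⟨i, hi, fun j hj => unique j i hj.1 hj.2 hi.1 hi.2⟩
    by_contra hne
    obtain ⟨a, ha⟩ := hlo'
    have h := sum_sub_card_mul_modEq O mlo mhi hlo a fun k _ => extreme k fun hk => hne ⟨k, hk⟩
    rw [hsum, ha, Nat.sub_self, Nat.ModEq, Nat.zero_mod] at h
    omega
  · intro i hi hi'
    have h := sum_sub_card_mul_modEq O mlo mhi hlo i fun k hki =>
      extreme k fun hk => hki (unique k i hk.1 hk.2 hi hi')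
    rw [hsum, Nat.ModEq, Nat.mod_eq_of_lt (a := O i - mlo) (by omega)] at h
    omega
end

section
/- Let O_1,…,O_P (P ≥ 1) be the sizes of the classes of a partition of n elements (each O_i ≥ 1, Σ O_i = n), let m̲ = min_i O_i, m̄ = max_i O_i, and R = n − P·m̲. Suppose m̄ − m̲ > 0, R mod (m̄ − m̲) = 0, and S = Σ_i O_i² is maximal among all positive size vectors with sum n, minimum m̲ and maximum m̄. Then every class size equals m̲ or m̄, i.e., there is no index i with m̲ < O_i < m̄. -/
/-- The effect on `∑ k, f (O k)` of changing two values of `O`. -/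
theorem sum_comp_update_update {ι α : Type*} [Fintype ι] [DecidableEq ι] (f : α → ℕ) (O : ι → α)
    {i j : ι} (hij : i ≠ j) (a b : α) :
    ∑ k, f (Function.update (Function.update O i a) j b k) + (f (O i) + f (O j)) =
      ∑ k, f (O k) + (f a + f b) := by
  have hi : i ∈ Finset.univ.erase j := by simp [hij]
  have hrest : ∑ k ∈ (Finset.univ.erase j).erase i,
      f (Function.update (Function.update O i a) j b k) =
        ∑ k ∈ (Finset.univ.erase j).erase i, f (O k) := by
    refine Finset.sum_congr rfl fun k hk => ?_
    simp only [Finset.mem_erase, Finset.mem_univ, and_true] at hk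
    simp [Function.update_of_ne hk.1, Function.update_of_ne hk.2]
  rw [← Finset.add_sum_erase _ _ (Finset.mem_univ j), ← Finset.add_sum_erase _ _ hi, hrest,
    ← Finset.add_sum_erase _ (fun k => f (O k)) (Finset.mem_univ j),
    ← Finset.add_sum_erase _ (fun k => f (O k)) hi]
  simp only [Function.update_self, Function.update_of_ne hij]
  ring

/-- Moving one unit from a smaller to a larger value, both strictly between the bounds, keeps the
sum and the extreme values and increases the sum of squares. -/
theorem exists_sum_sq_lt_of_two_middle {ι : Type*} [Fintype ι] (O : ι → ℕ) {lo hi : ℕ}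
    (hlo : ∀ k, lo ≤ O k) (hlo' : ∃ k, O k = lo) (hhi : ∀ k, O k ≤ hi) (hhi' : ∃ k, O k = hi)
    {i j : ι} (hij : i ≠ j) (hle : O i ≤ O j) (hi_lo : lo < O i) (hj_hi : O j < hi) :
    ∃ O' : ι → ℕ, ∑ k, O' k = ∑ k, O k ∧ (∀ k, lo ≤ O' k) ∧ (∃ k, O' k = lo) ∧
      (∀ k, O' k ≤ hi) ∧ (∃ k, O' k = hi) ∧ ∑ k, O k ^ 2 < ∑ k, O' k ^ 2 := by
  classical
  obtain ⟨a, ha⟩ := hlo'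
  obtain ⟨b, hb⟩ := hhi'
  obtain ⟨c, hc⟩ : ∃ c, O i = c + 1 := ⟨O i - 1, by omega⟩
  refine ⟨Function.update (Function.update O i c) j (O j + 1), ?_, ?_, ⟨a, ?_⟩, ?_, ⟨b, ?_⟩, ?_⟩
  · have h := sum_comp_update_update id O hij c (O j + 1)
    simp only [id] at h
    omega
  · intro k
    have := hlo k
    simp only [Function.update_apply]
    split_ifs <;> omega
  · have hai : a ≠ i := by rintro rfl; omega
    have haj : a ≠ j := by rintro rfl; omega
    simp [hai, haj, ha]
  · intro k
    have := hhi k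
    simp only [Function.update_apply]
    split_ifs <;> omega
  · have hbi : b ≠ i := by rintro rfl; omega
    have hbj : b ≠ j := by rintro rfl; omega
    simp [hbi, hbj, hb]
  · have h := sum_comp_update_update (· ^ 2) O hij c (O j + 1)
    simp only [hc] at h hle
    nlinarith

/-- If all values except possibly one equal one of two bounds and the total excess over the lower
bound is a multiple of the gap, then the gap divides the remaining excess too. -/
theorem sub_dvd_sub_of_forall_ne {ι : Type*} [Fintype ι] (O : ι → ℕ) {lo hi : ℕ}
    (hlo : ∀ k, lo ≤ O k) (hdvd : hi - lo ∣ ∑ k, O k - Fintype.card ι * lo) (i : ι)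
    (hne : ∀ k, k ≠ i → O k = lo ∨ O k = hi) : hi - lo ∣ O i - lo := by
  classical
  have hexcess : ∑ k, (O k - lo) = ∑ k, O k - Fintype.card ι * lo := by
    rw [Finset.sum_tsub_distrib _ fun k _ => hlo k]
    simp
  rw [← hexcess, ← Finset.add_sum_erase _ _ (Finset.mem_univ i)] at hdvd
  refine (Nat.dvd_add_left (Finset.dvd_sum fun k hk => ?_)).1 hdvd
  rcases hne k (Finset.ne_of_mem_erase hk) with h | h <;> simp [h]


/-- If `S = Σ Oᵢ²` is maximal, `mhi - mlo > 0` and `R mod (mhi - mlo) = 0`, then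
no class size lies strictly between `mlo` and `mhi`. -/
theorem partition_no_middle_of_maximal
    (n P : ℕ) (hP : 1 ≤ P) (O : Fin P → ℕ)
    (hO : ∀ i, 1 ≤ O i) (hsum : ∑ i, O i = n)
    (mlo mhi : ℕ)
    (hlo : ∀ i, mlo ≤ O i) (hlo' : ∃ i, O i = mlo)
    (hhi : ∀ i, O i ≤ mhi) (hhi' : ∃ i, O i = mhi)
    (hrange : 0 < mhi - mlo)
    (hmod : (n - P * mlo) % (mhi - mlo) = 0)
    (hmaximal : ∀ O' : Fin P → ℕ, (∀ k, 1 ≤ O' k) → (∑ k, O' k = n) →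
      (∀ k, mlo ≤ O' k) → (∃ k, O' k = mlo) →
      (∀ k, O' k ≤ mhi) → (∃ k, O' k = mhi) →
      ∑ k, (O' k) ^ 2 ≤ ∑ k, (O k) ^ 2) :
    ¬ ∃ i, mlo < O i ∧ O i < mhi := by
  rintro ⟨i, hi_lo, hi_hi⟩
  have no_pair : ∀ j k, j ≠ k → O j ≤ O k → mlo < O j → O k < mhi → False := by
    intro j k hjk hle hj hk
    obtain ⟨O', hsum', hl, hl', hh, hh', hlt⟩ :=
      exists_sum_sq_lt_of_two_middle O hlo hlo' hhi hhi' hjk hle hj hk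
    have hpos : 1 ≤ mlo := by
      obtain ⟨a, ha⟩ := hlo'
      exact ha ▸ hO a
    exact (hmaximal O' (fun k => hpos.trans (hl k)) (hsum'.trans hsum) hl hl' hh hh').not_gt hlt
  have hdvd : mhi - mlo ∣ O i - mlo := by
    refine sub_dvd_sub_of_forall_ne O hlo ?_ i fun k hk => ?_
    · rw [hsum, Fintype.card_fin]
      exact Nat.dvd_of_mod_eq_zero hmod
    · by_contra! h
      have hk_lo : mlo < O k := lt_of_le_of_ne (hlo k) h.1.symm
      have hk_hi : O k < mhi := lt_of_le_of_ne (hhi k) h.2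
      rcases le_total (O k) (O i) with hle | hle
      · exact no_pair k i hk hle hk_lo hi_hi
      · exact no_pair i k hk.symm hle hi_lo hk_hi
  have := Nat.le_of_dvd (by omega) hdvd
  omega
end

section
/- Let O_1,…,O_P (P ≥ 1) be the sizes of the classes of a partition of n elements (each O_i ≥ 1, Σ O_i = n), let m̲ = min_i O_i, m̄ = max_i O_i, and R = n − P·m̲, and suppose m̄ − m̲ > 0. Let o_max = |{i : O_i = m̄}| and o_min = |{i : O_i = m̲}|. Then o_max ≤ ⌊R / (m̄ − m̲)⌋ and o_min ≤ P − ⌈R / (m̄ − m̲)⌉. Moreover, if S = Σ_i O_i² is maximal among all positive size vectors with sum n, minimum m̲ and maximum m̄, then both inequalities hold with equality: o_max = ⌊R / (m̄ − m̲)⌋ and o_min = P − ⌈R / (m̄ − m̲)⌉. -/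
open Finset in
/-- Each part contributes at least `mlo`, with a surplus of `mhi - mlo` at a maximal part and of
between `1` and `mhi - mlo - 1` at a part that is neither minimal nor maximal. -/
theorem sum_bounds_of_extremal_counts {ι : Type*} [Fintype ι] (O : ι → ℕ) {mlo mhi : ℕ}
    (hlo : ∀ i, mlo ≤ O i) (hhi : ∀ i, O i ≤ mhi) (hlt : mlo < mhi) :
    #{i | O i = mhi} + #{i | O i = mlo} + #{i | O i ≠ mlo ∧ O i ≠ mhi} = Fintype.card ι ∧
    Fintype.card ι * mlo + #{i | O i = mhi} * (mhi - mlo) + #{i | O i ≠ mlo ∧ O i ≠ mhi} ≤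
      ∑ i, O i ∧
    ∑ i, O i + #{i | O i ≠ mlo ∧ O i ≠ mhi} ≤
      Fintype.card ι * mlo + #{i | O i = mhi} * (mhi - mlo) +
        #{i | O i ≠ mlo ∧ O i ≠ mhi} * (mhi - mlo) := by
  have hcard : Fintype.card ι = ∑ _i : ι, 1 := by simp
  simp only [card_filter, hcard, sum_mul, ← sum_add_distrib]
  refine ⟨sum_congr rfl fun i _ => ?_, sum_le_sum fun i _ => ?_, sum_le_sum fun i _ => ?_⟩ <;>
    have h₁ := hlo i <;> have h₂ := hhi i <;>
    by_cases h₃ : O i = mlo <;> by_cases h₄ : O i = mhi <;> simp [h₃, h₄] <;> omega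

/-- Moving one unit from a part to another part that is at least as large increases the sum of
squares. -/
theorem exists_transfer_sum_sq_lt {ι : Type*} [Fintype ι] [DecidableEq ι] (O : ι → ℕ) {i j : ι}
    (hij : i ≠ j) (hle : O j ≤ O i) (hpos : 1 ≤ O j) :
    ∃ O' : ι → ℕ, O' i = O i + 1 ∧ O' j = O j - 1 ∧ (∀ k, k ≠ i → k ≠ j → O' k = O k) ∧
      ∑ k, O' k = ∑ k, O k ∧ ∑ k, O k ^ 2 < ∑ k, O' k ^ 2 := by
  let O' : ι → ℕ := fun k => if k = i then O i + 1 else if k = j then O j - 1 else O k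
  have hi : O' i = O i + 1 := by simp [O']
  have hj : O' j = O j - 1 := by simp [O', hij.symm]
  have hk : ∀ k, k ≠ i → k ≠ j → O' k = O k := fun k h₁ h₂ => by simp [O', h₁, h₂]
  refine ⟨O', hi, hj, hk, ?_, ?_⟩
  · have h : ∑ k, (O' k + if k = j then 1 else 0) = ∑ k, (O k + if k = i then 1 else 0) := by
      refine Finset.sum_congr rfl fun k _ => ?_
      by_cases h₁ : k = i
      · subst h₁
        simp [hi, hij]
      · by_cases h₂ : k = j
        · subst h₂
          simp [hj, h₁, hpos]
        · simp [hk k h₁ h₂, h₁, h₂]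
    simpa [Finset.sum_add_distrib] using h
  · have h : ∑ k, (O' k ^ 2 + if k = j then 2 * O j else 0) =
        ∑ k, (O k ^ 2 + (if k = i then 2 * O i + 1 else 0) + if k = j then 1 else 0) := by
      refine Finset.sum_congr rfl fun k _ => ?_
      by_cases h₁ : k = i
      · subst h₁
        simp only [hi, hij, if_true, if_false]
        ring
      · by_cases h₂ : k = j
        · subst h₂
          obtain ⟨m, hm⟩ := Nat.exists_eq_add_of_le' hpos
          simp only [hj, h₁, if_true, if_false, hm, Nat.add_sub_cancel]
          ring
        · simp [hk k h₁ h₂, h₁, h₂]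
    simp only [Finset.sum_add_distrib, Finset.sum_ite_eq', Finset.mem_univ, if_true] at h
    omega


/-- Bounds on the number of classes attaining the maximum and the minimum size:
`o_max ≤ ⌊R/(mhi-mlo)⌋` and `o_min ≤ P - ⌈R/(mhi-mlo)⌉`, with equality in both
when the sum of squares is maximal. -/
theorem partition_count_min_max_bounds
    (n P : ℕ) (hP : 1 ≤ P) (O : Fin P → ℕ)
    (hO : ∀ i, 1 ≤ O i) (hsum : ∑ i, O i = n)
    (mlo mhi : ℕ)
    (hlo : ∀ i, mlo ≤ O i) (hlo' : ∃ i, O i = mlo)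
    (hhi : ∀ i, O i ≤ mhi) (hhi' : ∃ i, O i = mhi)
    (hrange : 0 < mhi - mlo)
    (R omax omin : ℕ)
    (hR : R = n - P * mlo)
    (homax : omax = (Finset.univ.filter (fun i => O i = mhi)).card)
    (homin : omin = (Finset.univ.filter (fun i => O i = mlo)).card) :
    omax ≤ R / (mhi - mlo) ∧
    omin ≤ P - (R + (mhi - mlo) - 1) / (mhi - mlo) ∧
    ((∀ O' : Fin P → ℕ, (∀ k, 1 ≤ O' k) → (∑ k, O' k = n) →
        (∀ k, mlo ≤ O' k) → (∃ k, O' k = mlo) →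
        (∀ k, O' k ≤ mhi) → (∃ k, O' k = mhi) →
        ∑ k, (O' k) ^ 2 ≤ ∑ k, (O k) ^ 2) →
      omax = R / (mhi - mlo) ∧
      omin = P - (R + (mhi - mlo) - 1) / (mhi - mlo)) := by
 
  have hlt : mlo < mhi := by omega
  obtain ⟨hcard, hlower, hupper⟩ := sum_bounds_of_extremal_counts O hlo hhi hlt
  rw [Fintype.card_fin] at hcard hlower hupper
  rw [hsum] at hlower hupper
  rw [← homax, ← homin] at hcard
  rw [← homax] at hlower hupper
  have hmid : (∀ O' : Fin P → ℕ, (∀ k, 1 ≤ O' k) → (∑ k, O' k = n) →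
        (∀ k, mlo ≤ O' k) → (∃ k, O' k = mlo) →
        (∀ k, O' k ≤ mhi) → (∃ k, O' k = mhi) →
        ∑ k, (O' k) ^ 2 ≤ ∑ k, (O k) ^ 2) →
      (Finset.univ.filter (fun i => O i ≠ mlo ∧ O i ≠ mhi)).card ≤ 1 := by
    intro hmax
    by_contra! hcon
    obtain ⟨i, hi, j, hj, hij⟩ := Finset.one_lt_card.mp hcon
    simp only [Finset.mem_filter, Finset.mem_univ, true_and] at hi hj
    wlog hle : O j ≤ O i generalizing i j
    · exact this j i hij.symm hj hi (by omega)
    obtain ⟨O', hi', hj', hk', hs, hsq⟩ := exists_transfer_sum_sq_lt O hij hle (hO j)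
    obtain ⟨p, hp⟩ := hlo'
    obtain ⟨q, hq⟩ := hhi'
    have hbounds : ∀ k, mlo ≤ O' k ∧ O' k ≤ mhi ∧ 1 ≤ O' k := by
      intro k
      have := hO p
      have := hlo i
      have := hhi i
      have := hlo j
      have := hhi j
      rcases eq_or_ne k i with rfl | h₁
      · omega
      rcases eq_or_ne k j with rfl | h₂
      · omega
      rw [hk' k h₁ h₂]
      exact ⟨hlo k, hhi k, hO k⟩
    have hp' : O' p = mlo := by
      rw [hk' p (by rintro rfl; omega) (by rintro rfl; omega), hp]
    have hq' : O' q = mhi := by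
      rw [hk' q (by rintro rfl; omega) (by rintro rfl; omega), hq]
    exact absurd (hmax O' (fun k => (hbounds k).2.2) (hs.trans hsum) (fun k => (hbounds k).1)
      ⟨p, hp'⟩ (fun k => (hbounds k).2.1) ⟨q, hq'⟩) (by omega)
  generalize (Finset.univ.filter (fun i => O i ≠ mlo ∧ O i ≠ mhi)).card = c at *
  generalize mhi - mlo = D at *
  have hRlower : omax * D + c ≤ R := by omega
  have hRupper : R + c ≤ (omax + c) * D := by
    rw [add_mul]
    omega
  have hceil : (R + D - 1) / D ≤ omax + c :=
    Nat.le_of_lt_succ ((Nat.div_lt_iff_lt_mul hrange).2 (by rw [Nat.succ_mul]; omega))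
  refine ⟨(Nat.le_div_iff_mul_le hrange).2 (by omega), by omega, fun hmax => ?_⟩
  have hc := hmid hmax
  have hceil' : omax + c ≤ (R + D - 1) / D := by
    rw [Nat.le_div_iff_mul_le hrange]
    interval_cases c <;> simp only [add_mul] <;> omega
  refine ⟨le_antisymm ((Nat.le_div_iff_mul_le hrange).2 (by omega)) ?_, by omega⟩
  refine Nat.le_of_lt_succ ((Nat.div_lt_iff_lt_mul hrange).2 ?_)
  rw [Nat.succ_mul]
  interval_cases c <;> simp only [add_mul] at hRupper <;> omega
end

section
/- Let O_1,…,O_P (P ≥ 1) be the sizes of the classes of a partition of n elements (each O_i ≥ 1, Σ O_i = n), let m̲ = min_i O_i, m̄ = max_i O_i, and S = Σ_i O_i². Define R = n − P·m̲; if m̄ − m̲ > 0 set MID = m̲ + (R mod (m̄ − m̲)) and RR = ⌊R / (m̄ − m̲)⌋, and otherwise set MID = m̲ and RR = 0; further set SM = m̄² − m̲² and SMIN = m̲²·(P − 1). Then S ≤ MID² + SM·RR + SMIN. -/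
theorem mod_sq_add_div_add_sq_le (d a x : ℕ) (hx : x ≤ d) :
    (a % d) ^ 2 + d ^ 2 * (a / d) + x ^ 2 ≤ ((a + x) % d) ^ 2 + d ^ 2 * ((a + x) / d) := by
  rcases Nat.eq_zero_or_pos d with rfl | hd
  · obtain rfl : x = 0 := by omega
    simp
  have hr : a % d < d := Nat.mod_lt _ hd
  have ha : a % d + d * (a / d) = a := Nat.mod_add_div a d
  generalize a % d = r at *
  generalize a / d = q at *
  by_cases h : r + x < d
  · obtain ⟨hq, hm⟩ := (Nat.div_mod_unique hd).2 ⟨(by omega : r + x + d * q = a + x), h⟩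
    rw [hq, hm]
    nlinarith [Nat.zero_le (r * x)]
  · obtain ⟨s, hs⟩ := Nat.exists_eq_add_of_le (not_lt.1 h)
    obtain ⟨hq, hm⟩ := (Nat.div_mod_unique hd).2
      ⟨(by rw [mul_add]; omega : s + d * (q + 1) = a + x), by omega⟩
    rw [hq, hm]
    zify at *
    have hs_eq : (s : ℤ) = r + x - d := by linarith
    rw [hs_eq]
    nlinarith [mul_nonneg (sub_nonneg.2 hr.le) (sub_nonneg.2 hx)]

theorem sum_sq_le_mod_sq_add_div {ι : Type*} (s : Finset ι) (x : ι → ℕ) (d : ℕ)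
    (hx : ∀ i ∈ s, x i ≤ d) :
    ∑ i ∈ s, x i ^ 2 ≤ ((∑ i ∈ s, x i) % d) ^ 2 + d ^ 2 * ((∑ i ∈ s, x i) / d) := by
  classical
  induction s using Finset.induction_on with
  | empty => simp
  | insert i s hi ih =>
    rw [Finset.sum_insert hi, Finset.sum_insert hi, add_comm (x i ^ 2), add_comm (x i)]
    exact (Nat.add_le_add_right (ih fun j hj => hx j (Finset.mem_insert_of_mem hj)) _).trans
      (mod_sq_add_div_add_sq_le d _ _ (hx i (Finset.mem_insert_self i s)))

/-- Upper bound on the sum of squared class sizes: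
`S ≤ MID² + SM·RR + SMIN`. -/
theorem partition_sum_squares_upper_bound
    (n P : ℕ) (hP : 1 ≤ P) (O : Fin P → ℕ)
    (hO : ∀ i, 1 ≤ O i) (hsum : ∑ i, O i = n)
    (mlo mhi : ℕ)
    (hlo : ∀ i, mlo ≤ O i) (hlo' : ∃ i, O i = mlo)
    (hhi : ∀ i, O i ≤ mhi) (hhi' : ∃ i, O i = mhi)
    (R MID RR SM SMIN : ℕ)
    (hR : R = n - P * mlo)
    (hMID : MID = if 0 < mhi - mlo then mlo + R % (mhi - mlo) else mlo)
    (hRR : RR = if 0 < mhi - mlo then R / (mhi - mlo) else 0)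
    (hSM : SM = mhi ^ 2 - mlo ^ 2)
    (hSMIN : SMIN = mlo ^ 2 * (P - 1)) :
    ∑ i, (O i) ^ 2 ≤ MID ^ 2 + SM * RR + SMIN := by
  choose x hx using fun i => Nat.exists_eq_add_of_le (hlo i)
  obtain ⟨d, rfl⟩ := Nat.exists_eq_add_of_le ((hlo hlo'.choose).trans (hhi _))
  have hxd : ∀ i, x i ≤ d := fun i => by have := hx i; have := hhi i; omega
  have hn : n = P * mlo + ∑ i, x i := by
    rw [← hsum, Finset.sum_congr rfl fun i _ => hx i]
    simp [Finset.sum_add_distrib]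
  have hRx : R = ∑ i, x i := by omega
  have hSum : ∑ i, O i ^ 2 = P * mlo ^ 2 + 2 * mlo * R + ∑ i, x i ^ 2 := by
    rw [hRx, Finset.mul_sum, Finset.sum_congr rfl fun i _ => by rw [hx i, add_sq]]
    simp [Finset.sum_add_distrib]
  have hbound := sum_sq_le_mod_sq_add_div Finset.univ x d fun i _ => hxd i
  rw [← hRx] at hbound
  rw [Nat.add_sub_cancel_left] at hMID hRR
  have hMID' : MID = mlo + R % d := by
    rcases Nat.eq_zero_or_pos d with rfl | hd
    · have : R = 0 := by
        rw [hRx]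
        exact Finset.sum_eq_zero fun i _ => Nat.le_zero.1 (hxd i)
      simp [hMID, this]
    · rw [hMID, if_pos hd]
  have hRR' : RR = R / d := by
    rcases Nat.eq_zero_or_pos d with rfl | hd
    · simp [hRR]
    · rw [hRR, if_pos hd]
  have hSM' : SM = d ^ 2 + 2 * mlo * d := by
    rw [hSM, Nat.sub_eq_iff_eq_add (by gcongr; omega)]
    ring
  obtain ⟨p, rfl⟩ := Nat.exists_eq_add_of_le' hP
  have hdiv : R % d + d * (R / d) = R := Nat.mod_add_div R d
  rw [hSum, hMID', hRR', hSM', hSMIN, Nat.add_sub_cancel]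
  calc _ ≤ (p + 1) * mlo ^ 2 + 2 * mlo * R + ((R % d) ^ 2 + d ^ 2 * (R / d)) := by gcongr
    _ = (p + 1) * mlo ^ 2 + 2 * mlo * (R % d + d * (R / d)) +
        ((R % d) ^ 2 + d ^ 2 * (R / d)) := by rw [hdiv]
    _ = _ := by ring
end

section
/- Consider a binary sequence of length n with G stretches of 1s of lengths g_1,…,g_G (each g_i ≥ 1) and, when G ≥ 1, G−1 inter-distances of 0s of lengths d_1,…,d_{G−1} (each d_j ≥ 1), so that Σ_i g_i + Σ_j d_j ≤ n. Let ḡ = max_i g_i, g̲ = min_i g_i (both 0 when G = 0), rG = ḡ − g̲, D̄ = max_j d_j, D̲ = min_j d_j (both 0 when G ≤ 1), and rD = D̄ − D̲. If rG = n·rD then ḡ ≤ n + rG; otherwise ḡ ≤ ⌊(n − rG − rD − min(rD,1) − 1) / (min(rD,1) + 2)⌋ + rG. -/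
/-- A finite sum is at least any one of its terms plus a lower bound for each of the others. -/
theorem Fin.add_pred_mul_le_sum {m : ℕ} (f : Fin m → ℕ) (l : ℕ) (hl : ∀ i, l ≤ f i) (i : Fin m) :
    f i + (m - 1) * l ≤ ∑ j, f j := by
  rw [← Finset.add_sum_erase _ _ (Finset.mem_univ i)]
  have h := Finset.card_nsmul_le_sum (Finset.univ.erase i) f l fun j _ => hl j
  rw [Finset.card_erase_of_mem (Finset.mem_univ i), Finset.card_fin, smul_eq_mul] at h
  exact Nat.add_le_add_left h _


/-- Upper bound on the length of the longest stretch of 1s, in terms of the range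
`rG = ḡ - g̲` of stretch lengths and the range `rD = D̄ - D̲` of inter-distances. -/
theorem binseq_gmax_upper_bound
    (n G : ℕ) (g : Fin G → ℕ) (d : Fin (G - 1) → ℕ)
    (hg : ∀ i, 1 ≤ g i) (hd : ∀ j, 1 ≤ d j)
    (hlen : (∑ i, g i) + (∑ j, d j) ≤ n)
    (gmax gmin dmax dmin : ℕ)
    (hgmax₁ : ∀ i, g i ≤ gmax)
    (hgmax₂ : G = 0 → gmax = 0)
    (hgmax₃ : G ≠ 0 → ∃ i, g i = gmax)
    (hgmin₁ : ∀ i, gmin ≤ g i)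
    (hgmin₂ : G = 0 → gmin = 0)
    (hgmin₃ : G ≠ 0 → ∃ i, g i = gmin)
    (hdmax₁ : ∀ j, d j ≤ dmax)
    (hdmax₂ : G ≤ 1 → dmax = 0)
    (hdmax₃ : 2 ≤ G → ∃ j, d j = dmax)
    (hdmin₁ : ∀ j, dmin ≤ d j)
    (hdmin₂ : G ≤ 1 → dmin = 0)
    (hdmin₃ : 2 ≤ G → ∃ j, d j = dmin) :
    (gmax - gmin = n * (dmax - dmin) → gmax ≤ n + (gmax - gmin)) ∧
    (gmax - gmin ≠ n * (dmax - dmin) →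
      gmax ≤ (n - (gmax - gmin) - (dmax - dmin) - min (dmax - dmin) 1 - 1) /
               (min (dmax - dmin) 1 + 2) + (gmax - gmin)) := by
  rcases Nat.eq_zero_or_pos G with hG | hG
  · have h₁ := hgmax₂ hG
    have h₂ := hdmax₂ (by omega)
    subst h₁ h₂
    simp
  obtain ⟨i, hi⟩ := hgmax₃ hG.ne'
  obtain ⟨i', hi'⟩ := hgmin₃ hG.ne'
  have hsum := Fin.add_pred_mul_le_sum g gmin hgmin₁ i
  have hmin : 1 ≤ gmin := hi' ▸ hg i'
  have hle : gmin ≤ gmax := hi ▸ hgmin₁ i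
  rw [hi] at hsum
  refine ⟨fun _ => by omega, fun hne => ?_⟩
  have hG2 : 2 ≤ G := by
    by_contra hlt
    obtain rfl : G = 1 := by omega
    have h₁ : gmax = gmin := by rw [← hi, ← hi', Subsingleton.elim i i']
    have h₂ := hdmax₂ le_rfl
    subst h₁ h₂
    simp at hne
  obtain ⟨j, hj⟩ := hdmax₃ hG2
  obtain ⟨j', hj'⟩ := hdmin₃ hG2
  have hdsum := Fin.add_pred_mul_le_sum d dmin hdmin₁ j
  have hdmin : 1 ≤ dmin := hj' ▸ hd j'
  have hdle : dmin ≤ dmax := hj ▸ hdmin₁ j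
  rw [hj] at hdsum
  rcases hdle.eq_or_lt with heq | hlt
  · subst heq
    have h : 1 * gmin ≤ (G - 1) * gmin := Nat.mul_le_mul_right _ (by omega)
    simp only [Nat.sub_self, mul_zero] at hne
    simp only [Nat.sub_self, Nat.zero_min]
    omega
  · have hG3 : 3 ≤ G := by
      by_contra hlt3
      obtain rfl : G = 2 := by omega
      have : j = j' := Subsingleton.elim (α := Fin 1) j j'
      subst this
      omega
    have h : 2 * gmin ≤ (G - 1) * gmin := Nat.mul_le_mul_right _ (by omega)
    have h' : 1 * dmin ≤ (G - 1 - 1) * dmin := Nat.mul_le_mul_right _ (by omega)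
    rw [min_eq_right (by omega : 1 ≤ dmax - dmin)]
    omega
end
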